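/- Let π be any uniformly good bandit policy. Then for every reward distribution P ∈ 𝒫 with P(r,x) > 0 for all r ∈ 𝔯 and x ∈ X, one has liminf_{T→∞} Reg_π(T,P)/log(T) ≥ C(P), where C(P) is the value of the semi-infinite optimization problem C(P) = inf { Σ_{x∈X̃(P)} η(x)·Δ(x,P) : η ≥ 0, Dist(η,x,P) ≥ 1 for all x ∈ X̃(P) }. -/

import Mathlib

open scoped BigOperators Classical
open Filter

namespace Bandit

/-- Matrices indexed by rewards and arms; a reward distribution is such a matrix. -/
abbrev RMat (R X : Type*) := R → X → ℝ

section Core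

variable {R X : Type*} [Fintype R] [Fintype X] [Nonempty X]

/-- The set `𝒫_Ω` of all reward distributions. -/
def POmega : Set (RMat R X) :=
  {Q | (∀ r x, 0 ≤ Q r x) ∧ ∀ x : X, ∑ r : R, Q r x = 1}

/-- The interior of `T` in the topology relative to `S`. -/
def relIntIn (S T : Set (RMat R X)) : Set (RMat R X) :=
  {Q | Q ∈ T ∧ ∃ U : Set (RMat R X), IsOpen U ∧ Q ∈ U ∧ U ∩ S ⊆ T}

/-- Information distance `I(M', M)` between two nonnegative measures on a finite set. -/
noncomputable def infoDiv {α : Type*} [Fintype α] (M' M : α → ℝ) : EReal :=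
  if ∀ a, M a = 0 → M' a = 0 then
    ((∑ a : α, (M' a * Real.log (M' a / M a) - M' a + M a) : ℝ) : EReal)
  else ⊤

/-- Expected reward of arm `x` under reward distribution `Q` (reward values `v`). -/
def rewOf (v : R → ℝ) (Q : RMat R X) (x : X) : ℝ := ∑ r : R, v r * Q r x

/-- Optimal expected reward `Rew*`. -/
noncomputable def rewStar (v : R → ℝ) (Q : RMat R X) : ℝ :=
  Finset.univ.sup' Finset.univ_nonempty (rewOf v Q)

/-- The set `x*(Q)` of optimal arms. -/
def optArms (v : R → ℝ) (Q : RMat R X) : Set X := {x | rewOf v Q x = rewStar v Q}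

/-- The set `X̃(Q)` of suboptimal arms. -/
def subArms (v : R → ℝ) (Q : RMat R X) : Set X := {x | rewOf v Q x ≠ rewStar v Q}

noncomputable def optFinset (v : R → ℝ) (Q : RMat R X) : Finset X :=
  Finset.univ.filter fun x => rewOf v Q x = rewStar v Q

noncomputable def subFinset (v : R → ℝ) (Q : RMat R X) : Finset X :=
  Finset.univ.filter fun x => rewOf v Q x ≠ rewStar v Q

/-- The suboptimality gap `Δ(x, Q)`. -/
noncomputable def gapOf (v : R → ℝ) (Q : RMat R X) (x : X) : ℝ := rewStar v Q - rewOf v Q x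

/-- The set `Deceit(x', P)` of deceitful reward distributions. -/
def DeceitSet (v : R → ℝ) (PP : Set (RMat R X)) (x' : X) (P : RMat R X) :
    Set (RMat R X) :=
  {Q | Q ∈ PP ∧ (∀ x ∈ optArms v P, ∀ r, Q r x = P r x) ∧
    ∀ x ∈ optArms v P, rewOf v Q x < rewOf v Q x'}

/-- The objective `Σ_{x ∈ X̃(P)} η(x)·I(P(x), Q(x))`. -/
noncomputable def distObj (v : R → ℝ) (η : X → ℝ) (P Q : RMat R X) : EReal :=
  ∑ x ∈ subFinset v P, ((η x : ℝ) : EReal) * infoDiv (fun r => P r x) (fun r => Q r x)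

/-- The distance function `Dist(η, x', P)` (equal to `⊤` if `Deceit(x', P)` is empty). -/
noncomputable def DistFn (v : R → ℝ) (PP : Set (RMat R X)) (η : X → ℝ) (x' : X)
    (P : RMat R X) : EReal :=
  sInf (distObj v η P '' DeceitSet v PP x' P)

/-- The regret lower bound `C(P)`. -/
noncomputable def CFn (v : R → ℝ) (PP : Set (RMat R X)) (P : RMat R X) : EReal :=
  sInf {c : EReal | ∃ η : X → ℝ, (∀ x, 0 ≤ η x) ∧
    (∀ x ∈ subArms v P, 1 ≤ DistFn v PP η x P) ∧
    c = ((∑ x ∈ subFinset v P, η x * gapOf v P x : ℝ) : EReal)}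

/-- The maximal reward `Rew_max(x', P)` of arm `x'`. -/
noncomputable def rewMax (v : R → ℝ) (PP : Set (RMat R X)) (x' : X) (P : RMat R X) : ℝ :=
  sSup {c : ℝ | ∃ Q ∈ PP, (∀ x ∈ optArms v P, ∀ r, Q r x = P r x) ∧ c = rewOf v Q x'}

/-- The set `X̃_d(P)` of deceitful arms. -/
def deceitArms (v : R → ℝ) (PP : Set (RMat R X)) (P : RMat R X) : Set X :=
  {x | x ∈ subArms v P ∧ rewStar v P < rewMax v PP x P}

/-- The conic hull `𝒦 = cone(𝒫)`. -/
def coneP (PP : Set (RMat R X)) : Set (RMat R X) :=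
  {Q | ∃ θ : ℝ, 0 ≤ θ ∧ ∃ Q' ∈ PP, Q = θ • Q'}

/-- The dual cone `𝒦*`. -/
def dualConeP (PP : Set (RMat R X)) : Set (RMat R X) :=
  {l | ∀ Q ∈ coneP PP, 0 ≤ ∑ x : X, ∑ r : R, l r x * Q r x}

/-- Extended-real logarithm (with `elog t = ⊥` for `t ≤ 0`). -/
noncomputable def elog (t : ℝ) : EReal := if 0 < t then ((Real.log t : ℝ) : EReal) else ⊥

/-- The dual function `Dual(η, x', Q; μ)` for `μ = (α, β, λ)`. -/
noncomputable def dualFn (v : R → ℝ) (η : X → ℝ) (x' : X) (Q : RMat R X)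
    (α β : ℝ) (l : RMat R X) : EReal :=
  if ∀ x ∈ subFinset v Q, ∀ r : R,
      0 ≤ η x - l r x - β - α * v r * (if x = x' then 1 else 0) then
    (∑ x ∈ subFinset v Q, ∑ r : R,
      ((η x * Q r x : ℝ) : EReal) *
        elog ((η x - l r x - β - α * v r * (if x = x' then 1 else 0)) / η x)) +
    ((-(∑ x ∈ optFinset v Q, ∑ r : R, l r x * Q r x) + α * rewStar v Q +
        β * ((subFinset v Q).card : ℝ) : ℝ) : EReal)
  else ⊥

/-- The set `𝒫'` of reward distributions satisfying Assumption 1. -/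
def PPrime (v : R → ℝ) (PP : Set (RMat R X)) : Set (RMat R X) :=
  {P | P ∈ PP ∧ (∃ x₀ : X, optArms v P = {x₀}) ∧
    (∀ x : X, rewMax v PP x P ≠ rewStar v P) ∧ P ∈ relIntIn POmega PP}

/-- The dual-test function `Dualbar(η, x', Q; μ) = max_{ρ ≥ 0} Dual(η, x', Q; ρ·μ)`. -/
noncomputable def dualTest (v : R → ℝ) (η : X → ℝ) (x' : X) (Q : RMat R X)
    (μ : ℝ × ℝ × RMat R X) : EReal :=
  sSup {d : EReal | ∃ ρ : ℝ, 0 ≤ ρ ∧ d = dualFn v η x' Q (ρ * μ.1) (ρ * μ.2.1) (ρ • μ.2.2)}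

end Core

end Bandit

open scoped ENNReal

namespace Bandit

section Policy

variable {R X : Type*} [Fintype R] [Fintype X] [Nonempty X] [Nonempty R]
  [DecidableEq R] [DecidableEq X]

/-- The law of the history `(x₁, R₁(x₁), …, xₙ, Rₙ(xₙ))` after `n` rounds, for a
(possibly randomized) policy `π` that chooses the arm of each round measurably from the
past history, with rewards drawn from `P` independently across arms and rounds:
`histProb π P n h` is the probability that the history of the first `n` rounds equals `h`. -/
noncomputable def histProb (π : List (X × R) → PMF X) (P : RMat R X) :
    ℕ → List (X × R) → ℝ≥0∞
  | 0 => fun h => if h = [] then 1 else 0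
  | n + 1 => fun h' => ∑' h : List (X × R), histProb π P n h *
      ∑ x : X, ∑ r : R, if h' = h ++ [(x, r)] then π h x * ENNReal.ofReal (P r x) else 0

/-- The expected reward `E[Σ_r r·P(r, x_{t+1})]` collected in round `t+1`. -/
noncomputable def expRound (π : List (X × R) → PMF X) (P : RMat R X) (v : R → ℝ)
    (t : ℕ) : ℝ :=
  ∑' h : List (X × R), (histProb π P t h).toReal * ∑ x : X, (π h x).toReal * rewOf v P x

/-- The regret `Reg_π(T, P) = T·Rew*(P) − Σ_{t=1}^T E[Σ_r r·P(r, x_t)]`. -/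
noncomputable def Reg (π : List (X × R) → PMF X) (P : RMat R X) (v : R → ℝ)
    (T : ℕ) : ℝ :=
  T * rewStar v P - ∑ t ∈ Finset.range T, expRound π P v t

/-- A policy is uniformly good if for all `α > 0` and all `P ∈ 𝒫`,
`limsup_{T→∞} Reg_π(T,P)/T^α = 0`. -/
def UniformlyGood (v : R → ℝ) (PP : Set (RMat R X)) (π : List (X × R) → PMF X) : Prop :=
  ∀ α : ℝ, 0 < α → ∀ P ∈ PP,
    Filter.limsup (fun T : ℕ => ((Reg π P v T / (T : ℝ) ^ α : ℝ) : EReal))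
      Filter.atTop = 0

end Policy

lemma sum_toReal_policy {R X : Type*} [Fintype X] (π : List (X × R) → PMF X) (h : List (X × R)) :
    ∑ x, (π h x).toReal = 1 := by
  rw [← ENNReal.toReal_sum fun x _ => (π h).apply_ne_top x, ← tsum_fintype (L := .unconditional _),
    (π h).tsum_coe, ENNReal.toReal_one]

/-- The sum of `g` over the rounds of a history. -/
def histSum {R X : Type*} (g : X → R → ℝ) (h : List (X × R)) : ℝ := (h.map fun p => g p.1 p.2).sum

lemma histSum_append_singleton {R X : Type*} (g : X → R → ℝ) (h : List (X × R)) (x : X) (r : R) :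
    histSum g (h ++ [(x, r)]) = histSum g h + g x r := by
  simp [histSum]

section History

variable {R X : Type*} [Fintype R] [Fintype X] {π : List (X × R) → PMF X} {P Q : RMat R X}

/-- The expectation of a function of the history of the first `n` rounds. -/
noncomputable def histExp (π : List (X × R) → PMF X) (P : RMat R X) :
    ℕ → (List (X × R) → ℝ) → ℝ
  | 0, F => F []
  | n + 1, F => histExp π P n fun h =>
      ∑ x, ∑ r, (π h x).toReal * P r x * F (h ++ [(x, r)])

/-- The expected number of pulls of arm `x` during the first `n` rounds. -/
noncomputable def armPulls (π : List (X × R) → PMF X) (P : RMat R X) (n : ℕ) (x : X) : ℝ :=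
  ∑ t ∈ Finset.range n, histExp π P t fun h => (π h x).toReal

lemma histExp_add (n : ℕ) (F G : List (X × R) → ℝ) :
    histExp π P n (fun h => F h + G h) = histExp π P n F + histExp π P n G := by
  induction n generalizing F G with
  | zero => rfl
  | succ n ih => simp only [histExp, mul_add, Finset.sum_add_distrib, ih]

lemma histExp_const_mul (n : ℕ) (c : ℝ) (F : List (X × R) → ℝ) :
    histExp π P n (fun h => c * F h) = c * histExp π P n F := by
  induction n generalizing F with
  | zero => rfl
  | succ n ih => simp only [histExp, mul_left_comm _ c, ← Finset.mul_sum, ih]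

lemma histExp_const (hP : ∀ x, ∑ r, P r x = 1) (n : ℕ) (c : ℝ) :
    histExp π P n (fun _ => c) = c := by
  induction n with
  | zero => rfl
  | succ n ih =>
    simp only [histExp, ← Finset.sum_mul, ← Finset.mul_sum, hP, mul_one, sum_toReal_policy,
      one_mul, ih]

lemma histExp_sum {ι : Type*} (s : Finset ι) (n : ℕ) (F : ι → List (X × R) → ℝ) :
    histExp π P n (fun h => ∑ i ∈ s, F i h) = ∑ i ∈ s, histExp π P n (F i) := by
  induction s using Finset.induction_on with
  | empty => simpa using histExp_const_mul (π := π) (P := P) n 0 0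
  | insert a s ha ih => simp only [Finset.sum_insert ha, histExp_add, ih]

lemma histExp_mono (hP : ∀ r x, 0 ≤ P r x) {n : ℕ} {F G : List (X × R) → ℝ}
    (h : ∀ l, l.length = n → F l ≤ G l) : histExp π P n F ≤ histExp π P n G := by
  induction n generalizing F G with
  | zero => exact h [] rfl
  | succ n ih =>
    refine ih fun l hl => Finset.sum_le_sum fun x _ => Finset.sum_le_sum fun r _ => ?_
    exact mul_le_mul_of_nonneg_left (h _ (by simp [hl]))
      (mul_nonneg ENNReal.toReal_nonneg (hP r x))

lemma armPulls_nonneg (hP : ∀ r x, 0 ≤ P r x) (n : ℕ) (x : X) : 0 ≤ armPulls π P n x := by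
  refine Finset.sum_nonneg fun t _ => ?_
  have h := histExp_mono (π := π) hP (n := t) (F := fun _ => 0 * 0)
    (G := fun h => (π h x).toReal) fun l _ => by simp
  rwa [histExp_const_mul, zero_mul] at h

lemma sum_armPulls (hP : ∀ x, ∑ r, P r x = 1) (n : ℕ) : ∑ x, armPulls π P n x = n := by
  simp only [armPulls]
  rw [Finset.sum_comm]
  simp [← histExp_sum, sum_toReal_policy, histExp_const hP]

/-- The Wald identity for sums over the rounds of a history. -/
lemma histExp_histSum (hP : ∀ x, ∑ r, P r x = 1) (g : X → R → ℝ) (n : ℕ) :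
    histExp π P n (histSum g) = ∑ x, armPulls π P n x * ∑ r, P r x * g x r := by
  induction n with
  | zero => simp [histExp, histSum, armPulls]
  | succ n ih =>
    simp only [histExp, histSum_append_singleton, mul_add, Finset.sum_add_distrib, histExp_add,
      ← Finset.sum_mul, ← Finset.mul_sum, hP, sum_toReal_policy, one_mul, ih,
      armPulls, Finset.sum_range_succ, add_mul, histExp_sum, mul_assoc]
    congr 1
    refine Finset.sum_congr rfl fun x _ => ?_
    rw [mul_comm (histExp _ _ _ _), ← histExp_const_mul]
    simp only [mul_comm]

/-- Change of measure from `Q` to `P`. -/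
lemma histExp_change_measure (hP : ∀ r x, 0 < P r x) (hQ : ∀ r x, 0 < Q r x) (n : ℕ)
    (F : List (X × R) → ℝ) :
    histExp π Q n F = histExp π P n fun h =>
      Real.exp (-histSum (fun x r => Real.log (P r x / Q r x)) h) * F h := by
  induction n generalizing F with
  | zero => simp [histExp, histSum]
  | succ n ih =>
    simp only [histExp, ih, histSum_append_singleton, Finset.mul_sum]
    congr 1
    funext h
    refine Finset.sum_congr rfl fun x _ => Finset.sum_congr rfl fun r _ => ?_
    rw [neg_add, Real.exp_add, Real.exp_neg (Real.log _),
      Real.exp_log (div_pos (hP r x) (hQ r x))]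
    have := (hP r x).ne'
    field_simp

/-- A form of the Donsker–Varadhan inequality for the laws of histories. -/
lemma histExp_sub_log_two_le (hP : ∀ r x, 0 < P r x) (hP1 : ∀ x, ∑ r, P r x = 1)
    (hQ : ∀ r x, 0 < Q r x) {n : ℕ} {f : List (X × R) → ℝ}
    (hf : histExp π Q n (fun h => Real.exp (f h)) ≤ 2) :
    histExp π P n f - Real.log 2 ≤
      histExp π P n (histSum fun x r => Real.log (P r x / Q r x)) := by
  set L := histSum fun x r => Real.log (P r x / Q r x) with hL
  rw [histExp_change_measure hP hQ, ← hL] at hf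
  have h := histExp_mono (π := π) (fun r x => (hP r x).le) (n := n)
    (F := fun h => f h + ((-1) * L h + (1 - Real.log 2)))
    (G := fun h => 2⁻¹ * (Real.exp (-L h) * Real.exp (f h))) fun l _ => by
      have := Real.add_one_le_exp (-L l + f l - Real.log 2)
      rw [Real.exp_sub, Real.exp_log two_pos, Real.exp_add] at this
      linarith
  rw [histExp_add, histExp_add, histExp_const_mul, histExp_const_mul, histExp_const hP1] at h
  linarith

/-- If the arms of `A` are pulled rarely under `Q`, then the information gathered under `P` to
distinguish `P` from `Q` is large. -/
lemma information_lower_bound (hP : ∀ r x, 0 < P r x) (hP1 : ∀ x, ∑ r, P r x = 1)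
    (hQ : ∀ r x, 0 < Q r x) (hQ1 : ∀ x, ∑ r, Q r x = 1) (A : Finset X) {T : ℕ} (hT : 0 < T)
    {c : ℝ} (hc : Real.exp c * ∑ x ∈ A, armPulls π Q T x ≤ T) :
    c * ((∑ x ∈ A, armPulls π P T x) / T) - Real.log 2 ≤
      ∑ x, armPulls π P T x * ∑ r, P r x * Real.log (P r x / Q r x) := by
  have hT' : (0 : ℝ) < T := by exact_mod_cast hT
  set N : List (X × R) → ℝ := histSum fun x _ => if x ∈ A then 1 else 0 with hN
  have hexp : ∀ {M : RMat R X}, (∀ x, ∑ r, M r x = 1) →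
      histExp π M T N = ∑ x ∈ A, armPulls π M T x := fun {M} hM => by
    rw [hN, histExp_histSum hM]
    simp [hM, Finset.sum_ite_mem]
  have hN0 : ∀ l, 0 ≤ N l := fun l => by
    refine List.sum_nonneg fun a ha => ?_
    obtain ⟨p, -, rfl⟩ := List.mem_map.1 ha
    dsimp only
    split_ifs <;> norm_num
  have hN1 : ∀ l, N l ≤ l.length := fun l => by
    induction l with
    | nil => simp [hN, histSum]
    | cons p l ih =>
      simp only [hN, histSum, List.map_cons, List.sum_cons, List.length_cons] at ih ⊢
      push_cast
      split_ifs <;> linarith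
  have key := histExp_sub_log_two_le (π := π) hP hP1 hQ (n := T) (f := fun h => c / T * N h) ?_
  · rw [histExp_const_mul, hexp hP1, histExp_histSum hP1] at key
    calc _ = c / T * ∑ x ∈ A, armPulls π P T x - Real.log 2 := by ring
      _ ≤ _ := key
  · have h := histExp_mono (π := π) (fun r x => (hQ r x).le) (n := T)
      (F := fun h => Real.exp (c / T * N h)) (G := fun h => Real.exp c / T * N h + 1) fun l hl => by
        have h0 := hN0 l
        have h1 : N l / T ≤ 1 := (div_le_one hT').2 (hl ▸ hN1 l)
        have h2 : 0 ≤ N l / T := by positivity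
        have := convexOn_exp.2 (Set.mem_univ c) (Set.mem_univ 0) h2 (sub_nonneg.2 h1)
          (add_sub_cancel _ _)
        simp only [smul_eq_mul, mul_zero, add_zero, Real.exp_zero, mul_one] at this
        calc Real.exp (c / T * N l) = Real.exp (N l / T * c) := by congr 1; ring
          _ ≤ N l / T * Real.exp c + (1 - N l / T) := this
          _ ≤ Real.exp c / T * N l + 1 := by
            have : N l / T * Real.exp c = Real.exp c / T * N l := by ring
            linarith
    refine h.trans ?_
    rw [histExp_add, histExp_const_mul, histExp_const hQ1, hexp hQ1, div_mul_eq_mul_div]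
    have := (div_le_one hT').2 hc
    linarith

end History

section HistoryLaw

variable {R X : Type*} [Fintype R] [Fintype X] [DecidableEq R] [DecidableEq X]

lemma histProb_eq_zero (π : List (X × R) → PMF X) (P : RMat R X) {n : ℕ} {h : List (X × R)}
    (hn : h.length ≠ n) : histProb π P n h = 0 := by
  induction n generalizing h with
  | zero => simp_all [histProb]
  | succ n ih =>
    simp only [histProb, ENNReal.tsum_eq_zero, mul_eq_zero]
    intro l
    by_cases hl : l.length = n
    · right
      refine Finset.sum_eq_zero fun x _ => Finset.sum_eq_zero fun r _ => if_neg ?_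
      rintro rfl
      simp [hl] at hn
    · exact Or.inl (ih hl)

lemma histProb_ne_top (π : List (X × R) → PMF X) (P : RMat R X) (n : ℕ) (h : List (X × R)) :
    histProb π P n h ≠ ⊤ := by
  induction n generalizing h with
  | zero => simp only [histProb]; split_ifs <;> simp
  | succ n ih =>
    simp only [histProb]
    rw [tsum_eq_sum (s := (List.finite_length_eq (X × R) n).toFinset) fun l hl => by
      rw [histProb_eq_zero π P (by simpa using hl), zero_mul]]
    refine ENNReal.sum_ne_top.2 fun l _ => ENNReal.mul_ne_top (ih l) ?_
    refine ENNReal.sum_ne_top.2 fun x _ => ENNReal.sum_ne_top.2 fun r _ => ?_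
    split_ifs
    · exact ENNReal.mul_ne_top ((π l).apply_ne_top x) ENNReal.ofReal_ne_top
    · simp

lemma sum_histProb_mul (π : List (X × R) → PMF X) {P : RMat R X} (hP : ∀ r x, 0 ≤ P r x) (n : ℕ)
    (F : List (X × R) → ℝ) :
    ∑ h ∈ (List.finite_length_eq (X × R) n).toFinset, (histProb π P n h).toReal * F h =
      histExp π P n F := by
  induction n generalizing F with
  | zero =>
    rw [Finset.sum_eq_single []] <;> simp +contextual [histProb, histExp]
  | succ n ih =>
    rw [histExp, ← ih]
    have hstep : ∀ h', (histProb π P (n + 1) h').toReal =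
        ∑ h ∈ (List.finite_length_eq (X × R) n).toFinset, (histProb π P n h).toReal *
          ∑ x : X, ∑ r : R, if h' = h ++ [(x, r)] then (π h x).toReal * P r x else 0 := by
      intro h'
      simp only [histProb]
      have htop : ∀ (l : List (X × R)) (x : X) (r : R),
          (if h' = l ++ [(x, r)] then π l x * ENNReal.ofReal (P r x) else 0) ≠ ⊤ := by
        intro l x r
        split_ifs
        · exact ENNReal.mul_ne_top ((π l).apply_ne_top x) ENNReal.ofReal_ne_top
        · simp
      have htop' := fun l x => ENNReal.sum_ne_top.2 fun r (_ : r ∈ Finset.univ) => htop l x r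
      have htop'' := fun l => ENNReal.sum_ne_top.2 fun x (_ : x ∈ Finset.univ) => htop' l x
      rw [tsum_eq_sum (s := (List.finite_length_eq (X × R) n).toFinset) fun l hl => by
        rw [histProb_eq_zero π P (by simpa using hl), zero_mul],
        ENNReal.toReal_sum fun l _ => ENNReal.mul_ne_top (histProb_ne_top π P n l) (htop'' l)]
      refine Finset.sum_congr rfl fun l _ => ?_
      rw [ENNReal.toReal_mul, ENNReal.toReal_sum fun x _ => htop' l x]
      congr 1
      refine Finset.sum_congr rfl fun x _ => ?_
      rw [ENNReal.toReal_sum fun r _ => htop l x r]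
      refine Finset.sum_congr rfl fun r _ => ?_
      split_ifs
      · rw [ENNReal.toReal_mul, ENNReal.toReal_ofReal (hP r x)]
      · simp
    simp only [hstep, Finset.sum_mul]
    rw [Finset.sum_comm]
    refine Finset.sum_congr rfl fun l hl => ?_
    simp only [mul_assoc, Finset.sum_mul]
    rw [← Finset.mul_sum, Finset.sum_comm]
    congr 1
    refine Finset.sum_congr rfl fun x _ => ?_
    rw [Finset.sum_comm]
    refine Finset.sum_congr rfl fun r _ => ?_
    rw [Finset.sum_eq_single (l ++ [(x, r)])]
    · simp [mul_assoc]
    · intro b _ hb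
      simp [hb]
    · intro hb
      simp only [Set.Finite.mem_toFinset, Set.mem_ofPred_eq] at hl hb
      simp [hl] at hb

lemma tsum_histProb_mul (π : List (X × R) → PMF X) {P : RMat R X} (hP : ∀ r x, 0 ≤ P r x)
    (n : ℕ) (F : List (X × R) → ℝ) :
    ∑' h, (histProb π P n h).toReal * F h = histExp π P n F := by
  rw [← sum_histProb_mul π hP]
  refine tsum_eq_sum fun h hh => ?_
  rw [histProb_eq_zero π P (by simpa using hh), ENNReal.toReal_zero, zero_mul]

end HistoryLaw

section Gap

variable {R X : Type*} [Fintype R] [Fintype X] [Nonempty X]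

lemma rewOf_le_rewStar (v : R → ℝ) (Q : RMat R X) (x : X) : rewOf v Q x ≤ rewStar v Q :=
  Finset.le_sup' (rewOf v Q) (Finset.mem_univ x)

lemma gapOf_nonneg (v : R → ℝ) (Q : RMat R X) (x : X) : 0 ≤ gapOf v Q x :=
  sub_nonneg.2 (rewOf_le_rewStar v Q x)

lemma gapOf_pos {v : R → ℝ} {Q : RMat R X} {x : X} (hx : x ∈ subFinset v Q) :
    0 < gapOf v Q x :=
  sub_pos.2 ((rewOf_le_rewStar v Q x).lt_of_ne (Finset.mem_filter.1 hx).2)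

lemma sum_optFinset_add_sum_subFinset (v : R → ℝ) (Q : RMat R X) (f : X → ℝ) :
    ∑ x ∈ optFinset v Q, f x + ∑ x ∈ subFinset v Q, f x = ∑ x, f x :=
  Finset.sum_filter_add_sum_filter_not _ _ _

lemma sum_mul_gapOf (v : R → ℝ) (Q : RMat R X) (f : X → ℝ) :
    ∑ x, f x * gapOf v Q x = ∑ x ∈ subFinset v Q, f x * gapOf v Q x := by
  rw [← sum_optFinset_add_sum_subFinset v Q, Finset.sum_eq_zero, zero_add]
  intro x hx
  rw [gapOf, (Finset.mem_filter.1 hx).2, sub_self, mul_zero]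

end Gap

lemma coe_sum_ereal {ι : Type*} (s : Finset ι) (f : ι → ℝ) :
    ((∑ i ∈ s, f i : ℝ) : EReal) = ∑ i ∈ s, (f i : EReal) :=
  map_sum (⟨⟨Real.toEReal, EReal.coe_zero⟩, EReal.coe_add⟩ : ℝ →+ EReal) f s

section InfoDiv

variable {α : Type*} [Fintype α] {M' M : α → ℝ}

lemma infoDiv_nonneg (hM' : ∀ a, 0 < M' a) (hM : ∀ a, 0 ≤ M a) : 0 ≤ infoDiv M' M := by
  unfold infoDiv
  split_ifs with h
  · refine EReal.coe_nonneg.2 (Finset.sum_nonneg fun a _ => ?_)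
    have hMa : 0 < M a := (hM a).lt_of_ne fun h0 => (hM' a).ne' (h a h0.symm)
    have hlog := Real.log_le_sub_one_of_pos (div_pos hMa (hM' a))
    have hinv : Real.log (M' a / M a) = -Real.log (M a / M' a) := by
      rw [← Real.log_inv, inv_div]
    have hmul : M' a * (M a / M' a) = M a := mul_div_cancel₀ _ (hM' a).ne'
    rw [hinv]
    nlinarith [mul_le_mul_of_nonneg_left hlog (hM' a).le]
  · exact le_top

lemma infoDiv_eq_coe_sum (hM : ∀ a, 0 < M a) (h : ∑ a, M' a = ∑ a, M a) :
    infoDiv M' M = ((∑ a, M' a * Real.log (M' a / M a) : ℝ) : EReal) := by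
  rw [infoDiv, if_pos fun a ha => absurd ha (hM a).ne', Finset.sum_add_distrib,
    Finset.sum_sub_distrib, h, sub_add_cancel]

lemma infoDiv_eq_top (hM' : ∀ a, 0 < M' a) (h : ∃ a, M a = 0) : infoDiv M' M = ⊤ := by
  obtain ⟨a, ha⟩ := h
  exact if_neg fun h => (hM' a).ne' (h a ha)

end InfoDiv

section LimitPulls

variable {R X : Type*} [Fintype R] [Fintype X] [Nonempty X] [DecidableEq R] [DecidableEq X]

lemma Reg_eq_sum_armPulls (π : List (X × R) → PMF X) {P : RMat R X} (hP : P ∈ POmega)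
    (v : R → ℝ) (T : ℕ) : Reg π P v T = ∑ x, armPulls π P T x * gapOf v P x := by
  simp only [Reg, expRound, tsum_histProb_mul π hP.1, gapOf, mul_sub, Finset.sum_sub_distrib,
    ← Finset.sum_mul, sum_armPulls hP.2, histExp_sum]
  congr 1
  rw [Finset.sum_comm]
  simp only [armPulls, Finset.mul_sum, mul_comm _ (rewOf v P _), histExp_const_mul]

/-- The information gathered by a policy of small regret under a deceitful distribution `Q`. -/
lemma eventually_information_lower_bound {π : List (X × R) → PMF X} {v : R → ℝ} {P Q : RMat R X}
    (hP : P ∈ POmega) (hP0 : ∀ r x, 0 < P r x) (hQ : Q ∈ POmega) (hQ0 : ∀ r x, 0 < Q r x)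
    (heq : ∀ x ∈ optArms v P, ∀ r, Q r x = P r x) {x' : X}
    (hlt : ∀ x ∈ optArms v P, rewOf v Q x < rewOf v Q x') {α : ℝ}
    (hgood : Filter.limsup (fun T : ℕ => ((Reg π Q v T / (T : ℝ) ^ α : ℝ) : EReal)) atTop = 0) :
    ∀ᶠ T : ℕ in atTop,
      (1 - α) * Real.log T * ((∑ x ∈ optFinset v P, armPulls π P T x) / T) - Real.log 2 ≤
        ∑ x ∈ subFinset v P, armPulls π P T x * ∑ r, P r x * Real.log (P r x / Q r x) := by
  have hmem : ∀ x ∈ optFinset v P, x ∈ optArms v P := fun x hx => (Finset.mem_filter.1 hx).2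
  have hrew : ∀ x ∈ optFinset v P, rewOf v Q x = rewStar v P := fun x hx => by
    rw [← (Finset.mem_filter.1 hx).2]
    simp only [rewOf, heq x (hmem x hx)]
  have hδ : 0 < rewOf v Q x' - rewStar v P := by
    obtain ⟨x, -, hx⟩ := Finset.exists_mem_eq_sup' Finset.univ_nonempty (rewOf v P)
    have hx' : x ∈ optFinset v P := Finset.mem_filter.2 ⟨Finset.mem_univ x, hx.symm⟩
    rw [← hrew x hx']
    exact sub_pos.2 (hlt x (hmem x hx'))
  set δ := rewOf v Q x' - rewStar v P
  have hev : ∀ᶠ T : ℕ in atTop, ((Reg π Q v T / (T : ℝ) ^ α : ℝ) : EReal) < (δ : EReal) :=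
    eventually_lt_of_limsup_lt (by rw [hgood]; exact_mod_cast hδ)
  filter_upwards [hev, eventually_gt_atTop 0] with T hT hT0
  have hT0' : (0 : ℝ) < T := by exact_mod_cast hT0
  have hTα : 0 < (T : ℝ) ^ α := Real.rpow_pos_of_pos hT0' α
  have hreg : Reg π Q v T < δ * (T : ℝ) ^ α := (div_lt_iff₀ hTα).1 (EReal.coe_lt_coe_iff.1 hT)
  have hpulls : (∑ x ∈ optFinset v P, armPulls π Q T x) * δ ≤ Reg π Q v T := by
    rw [Reg_eq_sum_armPulls π hQ, Finset.sum_mul]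
    calc ∑ x ∈ optFinset v P, armPulls π Q T x * δ
        ≤ ∑ x ∈ optFinset v P, armPulls π Q T x * gapOf v Q x := by
          refine Finset.sum_le_sum fun x hx =>
            mul_le_mul_of_nonneg_left ?_ (armPulls_nonneg hQ.1 T x)
          rw [gapOf, hrew x hx]
          exact sub_le_sub_right (rewOf_le_rewStar v Q x') _
      _ ≤ ∑ x, armPulls π Q T x * gapOf v Q x :=
          Finset.sum_le_univ_sum_of_nonneg fun x =>
            mul_nonneg (armPulls_nonneg hQ.1 T x) (gapOf_nonneg v Q x)
  have hrare : ∑ x ∈ optFinset v P, armPulls π Q T x ≤ (T : ℝ) ^ α :=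
    le_of_mul_le_mul_right (by linarith) hδ
  have hexp : Real.exp ((1 - α) * Real.log T) = (T : ℝ) ^ (1 - α) := by
    rw [Real.rpow_def_of_pos hT0', mul_comm]
  have key := information_lower_bound (π := π) hP0 hP.2 hQ0 hQ.2 (optFinset v P) hT0
    (c := (1 - α) * Real.log T) (by
      calc _ ≤ (T : ℝ) ^ (1 - α) * (T : ℝ) ^ α := by rw [hexp]; gcongr
        _ = T := by rw [← Real.rpow_add hT0', sub_add_cancel, Real.rpow_one])
  refine key.trans_eq ?_
  rw [← sum_optFinset_add_sum_subFinset v P, Finset.sum_eq_zero, zero_add]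
  intro x hx
  simp [heq x (hmem x hx), div_self (hP0 _ x).ne']

/-- Every limit point `η` of the normalized numbers of pulls satisfies the information constraint
of a deceitful distribution `Q`. -/
lemma one_le_sum_mul_information {π : List (X × R) → PMF X} {v : R → ℝ} {P Q : RMat R X}
    (hP : P ∈ POmega) (hP0 : ∀ r x, 0 < P r x) (hQ : Q ∈ POmega) (hQ0 : ∀ r x, 0 < Q r x)
    (heq : ∀ x ∈ optArms v P, ∀ r, Q r x = P r x) {x' : X}
    (hlt : ∀ x ∈ optArms v P, rewOf v Q x < rewOf v Q x')
    (hgood : ∀ α : ℝ, 0 < α →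
      Filter.limsup (fun T : ℕ => ((Reg π Q v T / (T : ℝ) ^ α : ℝ) : EReal)) atTop = 0)
    {l : Filter ℕ} [l.NeBot] (hl : l ≤ atTop) {η : X → ℝ}
    (hη : ∀ x ∈ subFinset v P,
      Tendsto (fun T : ℕ => armPulls π P T x / Real.log T) l (nhds (η x))) :
    1 ≤ ∑ x ∈ subFinset v P, η x * ∑ r, P r x * Real.log (P r x / Q r x) := by
  have hlog : Tendsto (fun T : ℕ => Real.log T) l atTop :=
    (Real.tendsto_log_atTop.comp tendsto_natCast_atTop_atTop).mono_left hl
  have hlogdiv : Tendsto (fun T : ℕ => Real.log T / T) l (nhds 0) :=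
    (Real.isLittleO_log_id_atTop.tendsto_div_nhds_zero.comp
      tendsto_natCast_atTop_atTop).mono_left hl
  have hsub : Tendsto (fun T : ℕ => (∑ x ∈ subFinset v P, armPulls π P T x / Real.log T) *
      (Real.log T / T)) l (nhds 0) := by
    simpa using (tendsto_finsetSum _ hη).mul hlogdiv
  refine le_of_forall_pos_sub_le fun α hα => ?_
  have hleft : Tendsto (fun T : ℕ => (1 - α) *
      (1 - (∑ x ∈ subFinset v P, armPulls π P T x / Real.log T) * (Real.log T / T)) -
        Real.log 2 / Real.log T) l (nhds (1 - α)) := by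
    simpa using ((hsub.const_sub 1).const_mul (1 - α)).sub
      (hlog.const_div_atTop (Real.log 2))
  have hright : Tendsto (fun T : ℕ => ∑ x ∈ subFinset v P, armPulls π P T x / Real.log T *
      ∑ r, P r x * Real.log (P r x / Q r x)) l
      (nhds (∑ x ∈ subFinset v P, η x * ∑ r, P r x * Real.log (P r x / Q r x))) :=
    tendsto_finsetSum _ fun x hx => (hη x hx).mul_const _
  refine le_of_tendsto_of_tendsto hleft hright ?_
  filter_upwards [hl (eventually_information_lower_bound hP hP0 hQ hQ0 heq hlt (hgood α hα)),
    hlog.eventually_gt_atTop 0, hl (eventually_gt_atTop 0)] with T hT hT1 hT0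
  have hT0' : (T : ℝ) ≠ 0 := by exact_mod_cast (show 0 < T from hT0).ne'
  have hopt : (∑ x ∈ optFinset v P, armPulls π P T x) / T =
      1 - (∑ x ∈ subFinset v P, armPulls π P T x / Real.log T) * (Real.log T / T) := by
    rw [← Finset.sum_div, div_mul_div_cancel₀ hT1.ne', eq_sub_iff_add_eq, ← add_div,
      sum_optFinset_add_sum_subFinset, sum_armPulls hP.2, div_self hT0']
  rw [← hopt]
  calc _ = ((1 - α) * Real.log T * ((∑ x ∈ optFinset v P, armPulls π P T x) / T) -
        Real.log 2) / Real.log T := by field_simp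
    _ ≤ (∑ x ∈ subFinset v P, armPulls π P T x * ∑ r, P r x * Real.log (P r x / Q r x)) /
        Real.log T := div_le_div_of_nonneg_right hT hT1.le
    _ = _ := by simp only [Finset.sum_div, div_mul_eq_mul_div]

/-- If the normalized regret is frequently below `c`, then the normalized numbers of pulls have a
limit point of cost at most `c`. -/
lemma exists_limit_pulls (π : List (X × R) → PMF X) (v : R → ℝ) {P : RMat R X}
    (hP : P ∈ POmega) {c : ℝ} (hc : ∃ᶠ T : ℕ in atTop, Reg π P v T / Real.log T < c) :
    ∃ l : Filter ℕ, l.NeBot ∧ l ≤ atTop ∧ ∃ η : X → ℝ, (∀ x, 0 ≤ η x) ∧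
      (∀ x ∈ subFinset v P,
        Tendsto (fun T : ℕ => armPulls π P T x / Real.log T) l (nhds (η x))) ∧
      ∑ x ∈ subFinset v P, η x * gapOf v P x ≤ c := by
  have := Filter.frequently_iff_neBot.1 hc
  set U : Ultrafilter ℕ := Ultrafilter.of (atTop ⊓ 𝓟 {T : ℕ | Reg π P v T / Real.log T < c})
  have hU := Ultrafilter.of_le (atTop ⊓ 𝓟 {T : ℕ | Reg π P v T / Real.log T < c})
  have hUtop : (U : Filter ℕ) ≤ atTop := hU.trans inf_le_left
  have hUc : ∀ᶠ T : ℕ in U, Reg π P v T / Real.log T < c :=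
    hU.trans inf_le_right (mem_principal_self _)
  have hreg : ∀ T : ℕ, Reg π P v T / Real.log T =
      ∑ x ∈ subFinset v P, armPulls π P T x / Real.log T * gapOf v P x := fun T => by
    rw [Reg_eq_sum_armPulls π hP, sum_mul_gapOf, Finset.sum_div]
    simp only [div_mul_eq_mul_div]
  have hnonneg : ∀ (T : ℕ) (x : X), 0 ≤ armPulls π P T x / Real.log T := fun T x =>
    div_nonneg (armPulls_nonneg hP.1 T x) (Real.log_natCast_nonneg T)
  have hlim : ∀ x, ∃ a : ℝ, 0 ≤ a ∧ (x ∈ subFinset v P →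
      Tendsto (fun T : ℕ => armPulls π P T x / Real.log T) U (nhds a)) := by
    intro x
    by_cases hx : x ∈ subFinset v P
    · have hmem : ∀ᶠ T : ℕ in U,
          armPulls π P T x / Real.log T ∈ Set.Icc 0 (c / gapOf v P x) := by
        filter_upwards [hUc] with T hT
        refine ⟨hnonneg T x, (le_div_iff₀ (gapOf_pos hx)).2 (le_trans ?_ hT.le)⟩
        rw [hreg]
        exact Finset.single_le_sum
          (f := fun y => armPulls π P T y / Real.log T * gapOf v P y)
          (fun y _ => mul_nonneg (hnonneg T y) (gapOf_nonneg v P y)) hx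
      obtain ⟨a, ha, hlim⟩ := isCompact_Icc.ultrafilter_le_nhds
        (U.map fun T : ℕ => armPulls π P T x / Real.log T) (le_principal_iff.2 hmem)
      exact ⟨a, ha.1, fun _ => hlim⟩
    · exact ⟨0, le_rfl, fun h => absurd h hx⟩
  choose η hη0 hη using hlim
  refine ⟨U, inferInstance, hUtop, η, hη0, hη, ?_⟩
  refine le_of_tendsto (tendsto_finsetSum _ fun x hx => (hη x hx).mul_const (gapOf v P x)) ?_
  filter_upwards [hUc] with T hT
  exact (hreg T).symm.trans_le hT.le

end LimitPulls

section LowerBound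

variable {R X : Type*} [Fintype R] [Fintype X] [Nonempty X] [Nonempty R]
  [DecidableEq R] [DecidableEq X]

/-- regret lower bound, Proposition 1: for any uniformly good policy `π`
and any `P ∈ 𝒫` with `P(r,x) > 0` for all `r, x`,
`liminf_{T→∞} Reg_π(T,P)/log(T) ≥ C(P)`. -/
theorem regret_lower_bound
    (v : R → ℝ) (hv : ∀ r, 0 ≤ v r)
    (PP : Set (RMat R X)) (hsub : PP ⊆ POmega) (hconv : Convex ℝ PP)
    (hcomp : IsCompact PP) (hne : (relIntIn POmega PP).Nonempty)
    (π : List (X × R) → PMF X) (hgood : UniformlyGood v PP π)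
    (P : RMat R X) (hP : P ∈ PP) (hpos : ∀ r x, 0 < P r x) :
    CFn v PP P ≤
      Filter.liminf (fun T : ℕ => ((Reg π P v T / Real.log T : ℝ) : EReal))
        Filter.atTop := by
  have hPΩ := hsub hP
  by_contra! hlt
  obtain ⟨c, hc, hcC⟩ := EReal.lt_iff_exists_real_btwn.1 hlt
  obtain ⟨c', hcc', hc'C⟩ := EReal.lt_iff_exists_real_btwn.1 hcC
  rw [EReal.coe_lt_coe_iff] at hcc'
  obtain ⟨l, hl, hltop, η, hη0, hη, hηc⟩ := exists_limit_pulls π v hPΩ (c := c)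
    ((frequently_lt_of_liminf_lt (by isBoundedDefault) hc).mono fun T hT =>
      EReal.coe_lt_coe_iff.1 hT)
  set G := ∑ x ∈ subFinset v P, gapOf v P x
  have hG : 0 ≤ G := Finset.sum_nonneg fun x _ => gapOf_nonneg v P x
  set ε := (c' - c) / (G + 1)
  have hε : 0 < ε := div_pos (sub_pos.2 hcc') (by linarith)
  refine hc'C.not_ge ?_
  have hcost : ((∑ x ∈ subFinset v P, (η x + ε) * gapOf v P x : ℝ) : EReal) ≤ c' := by
    refine EReal.coe_le_coe_iff.2 ?_
    simp only [add_mul, Finset.sum_add_distrib, ← Finset.mul_sum]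
    have hεG : ε * (G + 1) = c' - c := div_mul_cancel₀ _ (by linarith)
    linarith [mul_add ε G 1]
  refine le_trans (sInf_le ⟨fun x => η x + ε, fun x => add_nonneg (hη0 x) hε.le, ?_, rfl⟩) hcost
  rintro x' -
  refine le_sInf ?_
  rintro _ ⟨Q, ⟨hQ, heq, hQlt⟩, rfl⟩
  have hQΩ := hsub hQ
  have hinfo : ∀ x, 0 ≤ infoDiv (fun r => P r x) (fun r => Q r x) := fun x =>
    infoDiv_nonneg (fun r => hpos r x) fun r => hQΩ.1 r x
  by_cases hQ0 : ∀ r x, 0 < Q r x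
  · have hcoe : ∀ x, infoDiv (fun r => P r x) (fun r => Q r x) =
        ((∑ r, P r x * Real.log (P r x / Q r x) : ℝ) : EReal) := fun x =>
      infoDiv_eq_coe_sum (fun r => hQ0 r x) ((hPΩ.2 x).trans (hQΩ.2 x).symm)
    have h1 := one_le_sum_mul_information hPΩ hpos hQΩ hQ0 heq hQlt
      (fun α hα => hgood α hα Q hQ) hltop hη
    simp only [distObj, hcoe, ← EReal.coe_mul, ← coe_sum_ereal]
    refine EReal.coe_le_coe_iff.2 (h1.trans (Finset.sum_le_sum fun x _ => ?_))
    have hx := hinfo x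
    rw [hcoe, EReal.coe_nonneg] at hx
    exact mul_le_mul_of_nonneg_right (by linarith) hx
  · push Not at hQ0
    obtain ⟨r, x, hrx⟩ := hQ0
    have hrx0 : Q r x = 0 := le_antisymm hrx (hQΩ.1 r x)
    have hx : x ∈ subFinset v P := Finset.mem_filter.2 ⟨Finset.mem_univ x, fun hopt =>
      (hpos r x).ne' ((heq x hopt r).symm.trans hrx0)⟩
    have hηε : ∀ y, (0 : EReal) < ((η y + ε : ℝ) : EReal) := fun y =>
      EReal.coe_pos.2 (add_pos_of_nonneg_of_pos (hη0 y) hε)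
    calc (1 : EReal) ≤ ⊤ := le_top
      _ = ((η x + ε : ℝ) : EReal) * infoDiv (fun r => P r x) (fun r => Q r x) := by
        rw [infoDiv_eq_top (fun r => hpos r x) ⟨r, hrx0⟩, EReal.mul_top_of_pos (hηε x)]
      _ ≤ distObj v (fun x => η x + ε) P Q :=
        Finset.single_le_sum
          (f := fun y => ((η y + ε : ℝ) : EReal) *
            infoDiv (fun r => P r y) (fun r => Q r y))
          (fun y _ => mul_nonneg (hηε y).le (hinfo y)) hx

end LowerBound

end Bandit
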